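/- Let E(C_n) denote the average, over all reduced words i₁⋯i_ℓ for the longest element w₀ ∈ S_n chosen uniformly at random, of the number of positions k ∈ {1,…,ℓ−1} with |i_k − i_{k+1}| > 1 (positions supporting a commutation). Then lim_{n→∞} E(C_n)/(n(n−1)/2) = 1. -/

import Mathlib

open scoped Classical


/-- The adjacent transposition `sᵢ ∈ S_n` swapping `i` and `i+1` (one-based),
for `i ∈ {1, …, n-1}`; junk value `1` otherwise. -/
def simpleRefl (n i : ℕ) : Equiv.Perm (Fin n) :=
  if h : 1 ≤ i ∧ i < n then Equiv.swap ⟨i - 1, by omega⟩ ⟨i, h.2⟩ else 1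

/-- The product `s_{i₁} ⋯ s_{i_m}` of the word `i₁ ⋯ i_m`. -/
def wordProd (n : ℕ) (l : List ℕ) : Equiv.Perm (Fin n) :=
  (l.map (simpleRefl n)).prod

/-- `l` is a word for `w`: letters in `{1, …, n-1}` and product `w`. -/
def IsWordFor (n : ℕ) (w : Equiv.Perm (Fin n)) (l : List ℕ) : Prop :=
  (∀ i ∈ l, 1 ≤ i ∧ i ≤ n - 1) ∧ wordProd n l = w

/-- `l` is a reduced word for `w`: a word for `w` of minimal length. -/
def IsReducedWordFor (n : ℕ) (w : Equiv.Perm (Fin n)) (l : List ℕ) : Prop :=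
  IsWordFor n w l ∧ ∀ l', IsWordFor n w l' → l.length ≤ l'.length

/-- The longest element `w₀ ∈ S_n`, `w₀(i) = n + 1 - i` in one-line notation. -/
def w₀ (n : ℕ) : Equiv.Perm (Fin n) := Fin.revPerm

/-- The number of positions of the word `l` supporting a commutation,
i.e. positions `k` with `|i_k - i_{k+1}| > 1`. -/
def commCount (l : List ℕ) : ℕ :=
  ((Finset.range (l.length - 1)).filter
    (fun k => 1 < |(l.getD k 0 : ℤ) - (l.getD (k+1) 0 : ℤ)|)).card

/-- The number of consecutive noncommuting pairs in the word `l`,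
i.e. positions `k` with `|i_k - i_{k+1}| = 1`. -/
def noncommCount (l : List ℕ) : ℕ :=
  ((Finset.range (l.length - 1)).filter
    (fun k => |(l.getD k 0 : ℤ) - (l.getD (k+1) 0 : ℤ)| = 1)).card

/-- The number of positions of `l` supporting a long braid move, i.e. positions `k`
with `(i_k, i_{k+1}, i_{k+2})` of the form `(i, i+1, i)` or `(i+1, i, i+1)`. -/
noncomputable def braidCount (l : List ℕ) : ℕ :=
  ((Finset.range (l.length - 2)).filter
    (fun k => ∃ i : ℕ,
      (l.getD k 0, l.getD (k+1) 0, l.getD (k+2) 0) = (i, i+1, i) ∨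
      (l.getD k 0, l.getD (k+1) 0, l.getD (k+2) 0) = (i+1, i, i+1))).card


/-- The average of the statistic `f` over all reduced words for `w₀ ∈ S_n`. -/
noncomputable def expectedStat (n : ℕ) (f : List ℕ → ℕ) : ℝ :=
  (∑ᶠ l ∈ {l : List ℕ | IsReducedWordFor n (w₀ n) l}, (f l : ℝ)) /
    (Nat.card {l : List ℕ // IsReducedWordFor n (w₀ n) l} : ℝ)

/-- The positions of a permutation forming an inversion. -/
def inversions {n : ℕ} (w : Equiv.Perm (Fin n)) : Finset (Fin n × Fin n) :=
  Finset.univ.filter fun p => p.1 < p.2 ∧ w p.2 < w p.1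

theorem mem_inversions {n : ℕ} {w : Equiv.Perm (Fin n)} {a b : Fin n} :
    (a, b) ∈ inversions w ↔ a < b ∧ w b < w a := by
  rw [inversions, Finset.mem_filter]
  exact and_iff_right (Finset.mem_univ _)

theorem simpleRefl_apply_val (n i : ℕ) (h₁ : 1 ≤ i) (h₂ : i < n) (q : Fin n) :
    (simpleRefl n i q : ℕ) =
      if (q : ℕ) + 1 = i then i else if (q : ℕ) = i then i - 1 else q := by
  rw [simpleRefl, dif_pos ⟨h₁, h₂⟩, Equiv.swap_apply_def]
  simp only [Fin.ext_iff]
  by_cases hq₁ : (q : ℕ) + 1 = i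
  · rw [if_pos (by omega), if_pos hq₁]
  · rw [if_neg (by omega), if_neg hq₁]
    split_ifs <;> rfl

theorem simpleRefl_apply_self_apply (n i : ℕ) (q : Fin n) :
    simpleRefl n i (simpleRefl n i q) = q := by
  unfold simpleRefl
  split_ifs <;> simp

theorem card_inversions_mul_simpleRefl_le {n : ℕ} (w : Equiv.Perm (Fin n)) (i : ℕ) :
    (inversions (w * simpleRefl n i)).card ≤ (inversions w).card + 1 := by
  by_cases h : 1 ≤ i ∧ i < n
  · have hsub : inversions (w * simpleRefl n i) ⊆
        insert ((⟨i - 1, by omega⟩, ⟨i, h.2⟩) : Fin n × Fin n)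
          ((inversions w).image fun p => (simpleRefl n i p.1, simpleRefl n i p.2)) := by
      rintro ⟨a, b⟩ hab
      rw [mem_inversions, Equiv.Perm.mul_apply, Equiv.Perm.mul_apply] at hab
      rw [Finset.mem_insert]
      by_cases he : (a : ℕ) = i - 1 ∧ (b : ℕ) = i
      · left
        simp only [Prod.mk.injEq, Fin.ext_iff]
        exact he
      · right
        refine Finset.mem_image.2 ⟨(simpleRefl n i a, simpleRefl n i b), ?_, ?_⟩
        · refine mem_inversions.2 ⟨?_, hab.2⟩
          have hlt : (a : ℕ) < b := hab.1
          rw [Fin.lt_def, simpleRefl_apply_val n i h.1 h.2, simpleRefl_apply_val n i h.1 h.2]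
          split_ifs <;> omega
        · simp [simpleRefl_apply_self_apply]
    calc _ ≤ _ := Finset.card_le_card hsub
      _ ≤ _ := Finset.card_insert_le _ _
      _ ≤ _ := Nat.add_le_add_right Finset.card_image_le 1
  · simp [simpleRefl, h]

theorem card_inversions_wordProd_le (n : ℕ) (l : List ℕ) :
    (inversions (wordProd n l)).card ≤ l.length := by
  induction l using List.reverseRecOn with
  | nil =>
    simp only [wordProd, List.map_nil, List.prod_nil, List.length_nil, Nat.le_zero,
      Finset.card_eq_zero, inversions, Equiv.Perm.one_apply]
    refine Finset.filter_eq_empty_iff.2 fun p _ hp => lt_asymm hp.1 hp.2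
  | append_singleton l a ih =>
    have : wordProd n (l ++ [a]) = wordProd n l * simpleRefl n a := by simp [wordProd]
    rw [this, List.length_append, List.length_singleton]
    exact (card_inversions_mul_simpleRefl_le _ _).trans (Nat.add_le_add_right ih 1)

theorem card_inversions_w₀ (n : ℕ) : (inversions (w₀ n)).card = n * (n - 1) / 2 := by
  have h : inversions (w₀ n) =
      ((Finset.univ : Finset (Fin n)).sigma (fun b => Finset.Iio b)).image
        (fun p => (p.2, p.1)) := by
    ext ⟨a, b⟩
    rw [mem_inversions]
    simp [w₀]
  rw [h, Finset.card_image_of_injective, Finset.card_sigma]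
  · simp only [Fin.card_Iio]
    rw [Fin.sum_univ_eq_sum_range (fun i => i), Finset.sum_range_id]
  · rintro ⟨a, b⟩ ⟨c, d⟩ h
    simp only [Prod.mk.injEq] at h
    obtain ⟨rfl, rfl⟩ := h
    rfl

theorem length_le_of_isWordFor_w₀ {n : ℕ} {l : List ℕ} (h : IsWordFor n (w₀ n) l) :
    n * (n - 1) / 2 ≤ l.length := by
  rw [← card_inversions_w₀, ← h.2]
  exact card_inversions_wordProd_le n l

/-- The letters of the `t`-th round of odd-even transposition sort. -/
def brickLayer (n t : ℕ) : List ℕ :=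
  (List.range ((n - t % 2) / 2)).map fun j => 2 * j + 1 + t % 2

theorem mem_brickLayer {n t i : ℕ} :
    i ∈ brickLayer n t ↔ 1 ≤ i ∧ i < n ∧ i % 2 = (t + 1) % 2 := by
  simp only [brickLayer, List.mem_map, List.mem_range]
  constructor
  · rintro ⟨j, hj, rfl⟩
    omega
  · rintro ⟨h₁, h₂, h₃⟩
    exact ⟨(i - 1 - t % 2) / 2, by omega, by omega⟩

theorem nodup_brickLayer (n t : ℕ) : (brickLayer n t).Nodup :=
  List.nodup_range.map fun a b h => by
    omega

theorem pairwise_of_perm_brickLayer {n t : ℕ} {l : List ℕ} (h : l.Perm (brickLayer n t)) :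
    l.Pairwise fun a b => a + 1 < b ∨ b + 1 < a := by
  have hn : l.Nodup := h.nodup_iff.2 (nodup_brickLayer n t)
  refine List.Pairwise.imp_of_mem ?_ hn
  intro a b ha hb hab
  have ha' := mem_brickLayer.1 (h.mem_iff.1 ha)
  have hb' := mem_brickLayer.1 (h.mem_iff.1 hb)
  omega

theorem wordProd_apply_of_pairwise {n : ℕ} {l : List ℕ} (hl : ∀ i ∈ l, 1 ≤ i ∧ i < n)
    (hp : l.Pairwise fun a b => a + 1 < b ∨ b + 1 < a) (q : Fin n) :
    (wordProd n l q : ℕ) =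
      if (q : ℕ) + 1 ∈ l then (q : ℕ) + 1 else if (q : ℕ) ∈ l then (q : ℕ) - 1 else q := by
  induction l with
  | nil => simp [wordProd]
  | cons a l ih =>
    rw [List.pairwise_cons] at hp
    have ha := hl a (by simp)
    have hw : wordProd n (a :: l) q = simpleRefl n a (wordProd n l q) := by simp [wordProd]
    rw [hw, simpleRefl_apply_val n a ha.1 ha.2,
      ih (fun i hi => hl i (List.mem_cons_of_mem _ hi)) hp.2]
    simp only [List.mem_cons]
    have h1 := hp.1 ((q : ℕ) + 1)
    have h2 := hp.1 (q : ℕ)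
    by_cases c1 : (q : ℕ) + 1 ∈ l <;> by_cases c2 : (q : ℕ) ∈ l <;>
      simp only [c1, c2, true_implies, if_true, if_false, or_true, or_false] at h1 h2 ⊢ <;>
      split_ifs <;> omega

/-- The words obtained by performing the first `t` rounds of odd-even transposition sort,
with the letters of each round in any order. -/
noncomputable def brickWords (n : ℕ) : ℕ → Finset (List ℕ)
  | 0 => {[]}
  | t + 1 => ((brickLayer n t).permutations.toFinset ×ˢ brickWords n t).image
      fun p => p.1 ++ p.2

theorem mem_brickWords_succ {n t : ℕ} {l : List ℕ} :
    l ∈ brickWords n (t + 1) ↔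
      ∃ a b, a.Perm (brickLayer n t) ∧ b ∈ brickWords n t ∧ a ++ b = l := by
  simp [brickWords, and_assoc]

theorem card_brickWords_succ (n t : ℕ) :
    (brickWords n (t + 1)).card = ((n - t % 2) / 2).factorial * (brickWords n t).card := by
  rw [brickWords, Finset.card_image_of_injOn, Finset.card_product,
    List.toFinset_card_of_nodup (List.nodup_permutations _ (nodup_brickLayer n t)),
    List.length_permutations]
  · simp [brickLayer]
  · rintro ⟨a, b⟩ hab ⟨c, d⟩ hcd h
    simp only [Finset.coe_product, Set.mem_prod, Finset.mem_coe, List.mem_toFinset,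
      List.mem_permutations] at hab hcd
    obtain ⟨rfl, rfl⟩ := List.append_inj h (hab.1.length_eq.trans hcd.1.length_eq.symm)
    rfl

theorem pow_factorial_le_card_brickWords (n t : ℕ) :
    ((n - 1) / 2).factorial ^ t ≤ (brickWords n t).card := by
  induction t with
  | zero => simp [brickWords]
  | succ t ih =>
    rw [card_brickWords_succ, pow_succ, mul_comm]
    exact Nat.mul_le_mul (Nat.factorial_le (by omega)) ih

theorem mem_letters_of_mem_brickWords {n t : ℕ} {l : List ℕ} (hl : l ∈ brickWords n t) :
    ∀ i ∈ l, 1 ≤ i ∧ i ≤ n - 1 := by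
  induction t generalizing l with
  | zero => simp_all [brickWords]
  | succ t ih =>
    obtain ⟨a, b, ha, hb, rfl⟩ := mem_brickWords_succ.1 hl
    intro i hi
    rcases List.mem_append.1 hi with h | h
    · have := mem_brickLayer.1 (ha.mem_iff.1 h)
      omega
    · exact ih hb i h

theorem length_of_mem_brickWords {n t : ℕ} {l : List ℕ} (hl : l ∈ brickWords n t) :
    l.length = ∑ j ∈ Finset.range t, (n - j % 2) / 2 := by
  induction t generalizing l with
  | zero => simp_all [brickWords]
  | succ t ih =>
    obtain ⟨a, b, ha, hb, rfl⟩ := mem_brickWords_succ.1 hl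
    rw [List.length_append, ih hb, ha.length_eq, Finset.sum_range_succ, add_comm]
    simp [brickLayer]

theorem sum_range_brickLayer_length (n : ℕ) :
    ∑ j ∈ Finset.range n, (n - j % 2) / 2 = n * (n - 1) / 2 := by
  have key (s : ℕ) (hn : 1 ≤ n) :
      ∑ j ∈ Finset.range (2 * s), (n - j % 2) / 2 = s * (n - 1) := by
    induction s with
    | zero => simp
    | succ s ih =>
      rw [show 2 * (s + 1) = 2 * s + 1 + 1 by ring, Finset.sum_range_succ,
        Finset.sum_range_succ, ih, add_mul]
      omega
  rcases Nat.even_or_odd' n with ⟨k, hk | hk⟩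
  · rcases Nat.eq_zero_or_pos n with h0 | h0
    · simp [h0]
    · nth_rewrite 1 [hk]
      rw [key k h0]
      nth_rewrite 2 [hk]
      rw [mul_assoc, Nat.mul_div_cancel_left _ two_pos]
  · nth_rewrite 1 [hk]
    rw [Finset.sum_range_succ, key k (by omega)]
    have h1 : n - 1 = 2 * k := by omega
    have h2 : (n - 2 * k % 2) / 2 = k := by omega
    rw [h2, h1, mul_left_comm n 2 k, Nat.mul_div_cancel_left _ two_pos, hk]
    ring

theorem wordProd_apply_of_mem_brickWords {n t : ℕ} (ht : t ≤ n) {l : List ℕ}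
    (hl : l ∈ brickWords n t) (q : Fin n) :
    (wordProd n l q : ℕ) =
      if (q : ℕ) % 2 = 0 then
        if (q : ℕ) + t < n then (q : ℕ) + t else 2 * n - 1 - (q + t)
      else if t ≤ q then (q : ℕ) - t else t - q - 1 := by
  induction t generalizing l with
  | zero => simp_all [brickWords, wordProd]
  | succ t ih =>
    obtain ⟨a, b, ha, hb, rfl⟩ := mem_brickWords_succ.1 hl
    have hw : wordProd n (a ++ b) q = wordProd n a (wordProd n b q) := by simp [wordProd]
    have hmem (i : ℕ) : i ∈ a ↔ 1 ≤ i ∧ i < n ∧ i % 2 = (t + 1) % 2 := by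
      rw [ha.mem_iff, mem_brickLayer]
    rw [hw, wordProd_apply_of_pairwise (fun i hi => ⟨((hmem i).1 hi).1, ((hmem i).1 hi).2.1⟩)
      (pairwise_of_perm_brickLayer ha)]
    simp only [hmem]
    have hq := q.isLt
    have hr := ih (by omega) hb
    generalize ((wordProd n b q : Fin n) : ℕ) = r at hr
    by_cases hpar : (q : ℕ) % 2 = 0
    · simp only [hpar, if_true] at hr ⊢
      split_ifs at hr <;> split_ifs <;> omega
    · simp only [hpar, if_false] at hr ⊢
      split_ifs at hr <;> split_ifs <;> omega

theorem isWordFor_of_mem_brickWords {n : ℕ} {l : List ℕ} (hl : l ∈ brickWords n n) :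
    IsWordFor n (w₀ n) l := by
  refine ⟨mem_letters_of_mem_brickWords hl, ?_⟩
  ext q
  rw [wordProd_apply_of_mem_brickWords le_rfl hl]
  have hq := q.isLt
  simp only [w₀, Fin.revPerm_apply, Fin.val_rev]
  split_ifs <;> omega

theorem length_of_mem_brickWords_self {n : ℕ} {l : List ℕ} (hl : l ∈ brickWords n n) :
    l.length = n * (n - 1) / 2 := by
  rw [length_of_mem_brickWords hl, sum_range_brickLayer_length]

theorem isReducedWordFor_of_mem_brickWords {n : ℕ} {l : List ℕ} (hl : l ∈ brickWords n n) :
    IsReducedWordFor n (w₀ n) l :=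
  ⟨isWordFor_of_mem_brickWords hl, fun l' hl' => by
    rw [length_of_mem_brickWords_self hl]
    exact length_le_of_isWordFor_w₀ hl'⟩

theorem brickWords_nonempty (n t : ℕ) : (brickWords n t).Nonempty :=
  Finset.card_pos.1 <| (pow_pos (Nat.factorial_pos _) t).trans_le
    (pow_factorial_le_card_brickWords n t)

theorem length_of_isReducedWordFor_w₀ {n : ℕ} {l : List ℕ}
    (h : IsReducedWordFor n (w₀ n) l) : l.length = n * (n - 1) / 2 := by
  obtain ⟨b, hb⟩ := brickWords_nonempty n n
  refine le_antisymm ?_ (length_le_of_isWordFor_w₀ h.1)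
  rw [← length_of_mem_brickWords_self hb]
  exact h.2 b (isWordFor_of_mem_brickWords hb)

/-- The words of length `k` with letters in `{1, …, n - 1}`. -/
noncomputable def wordsOfLength (n : ℕ) : ℕ → Finset (List ℕ)
  | 0 => {[]}
  | k + 1 => (Finset.Icc 1 (n - 1) ×ˢ wordsOfLength n k).image fun p => p.1 :: p.2

theorem mem_wordsOfLength {n k : ℕ} {l : List ℕ} :
    l ∈ wordsOfLength n k ↔ l.length = k ∧ ∀ i ∈ l, 1 ≤ i ∧ i ≤ n - 1 := by
  induction k generalizing l with
  | zero =>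
    simp only [wordsOfLength, Finset.mem_singleton, List.length_eq_zero_iff]
    constructor
    · rintro rfl
      simp
    · exact fun h => h.1
  | succ k ih =>
    cases l with
    | nil => simp [wordsOfLength]
    | cons a l => simp [wordsOfLength, ih, and_left_comm]

/-- The number of consecutive pairs of a word at distance at most one. -/
noncomputable def closeCount (l : List ℕ) : ℕ :=
  ((Finset.range (l.length - 1)).filter
    (fun k => ¬ 1 < |(l.getD k 0 : ℤ) - (l.getD (k+1) 0 : ℤ)|)).card

theorem commCount_add_closeCount (l : List ℕ) :
    commCount l + closeCount l = l.length - 1 := by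
  rw [commCount, closeCount, Finset.card_filter_add_card_filter_not, Finset.card_range]

theorem closeCount_cons_cons (a b : ℕ) (l : List ℕ) :
    closeCount (a :: b :: l) =
      (if 1 < |(a : ℤ) - b| then 0 else 1) + closeCount (b :: l) := by
  simp only [closeCount, Finset.card_filter, List.length_cons, Nat.add_sub_cancel]
  rw [Finset.sum_range_succ', add_comm]
  congr 1
  simp only [List.getD_cons_zero, List.getD_cons_succ]
  split_ifs <;> simp_all

theorem closeCount_le_cons (a : ℕ) (l : List ℕ) : closeCount l ≤ closeCount (a :: l) := by
  cases l with
  | nil => simp [closeCount]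
  | cons b l => rw [closeCount_cons_cons]; omega

theorem sum_pow_close_le (n b : ℕ) :
    ∑ a ∈ Finset.Icc 1 (n - 1), (n : ℝ) ^ (if 1 < |(b : ℤ) - a| then 0 else 1) ≤ 4 * n := by
  have h : ∀ a ∈ Finset.Icc 1 (n - 1),
      (n : ℝ) ^ (if 1 < |(b : ℤ) - a| then 0 else 1) ≤
        1 + if a ∈ Finset.Icc (b - 1) (b + 1) then (n : ℝ) else 0 := by
    intro a _
    have hc : 1 < |(b : ℤ) - a| ∨ a ∈ Finset.Icc (b - 1) (b + 1) := by
      rw [lt_abs, Finset.mem_Icc]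
      omega
    by_cases h1 : 1 < |(b : ℤ) - a|
    · simp only [h1, if_true, pow_zero]
      split_ifs <;> simp
    · simp [h1, hc.resolve_left h1]
  refine (Finset.sum_le_sum h).trans ?_
  rw [Finset.sum_add_distrib, ← Finset.sum_filter, Finset.sum_const, Finset.sum_const,
    nsmul_eq_mul, nsmul_eq_mul]
  have h1 : (((Finset.Icc 1 (n - 1)).card : ℕ) : ℝ) ≤ n := by
    rw [Nat.card_Icc]
    exact_mod_cast (by omega : n - 1 + 1 - 1 ≤ n)
  have h2 : ((((Finset.Icc 1 (n - 1)).filter (· ∈ Finset.Icc (b - 1) (b + 1))).card : ℕ) : ℝ)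
      ≤ 3 := by
    have : ((Finset.Icc 1 (n - 1)).filter (· ∈ Finset.Icc (b - 1) (b + 1))).card ≤ 3 := by
      calc _ ≤ (Finset.Icc (b - 1) (b + 1)).card :=
            Finset.card_le_card fun x hx => (Finset.mem_filter.1 hx).2
        _ ≤ 3 := by rw [Nat.card_Icc]; omega
    exact_mod_cast this
  nlinarith [mul_le_mul_of_nonneg_right h2 (Nat.cast_nonneg (α := ℝ) n)]

theorem sum_pow_closeCount_cons_le (n k b : ℕ) :
    ∑ l ∈ wordsOfLength n k, (n : ℝ) ^ closeCount (b :: l) ≤ (4 * n) ^ k := by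
  induction k generalizing b with
  | zero => simp [wordsOfLength, closeCount]
  | succ k ih =>
    rw [wordsOfLength, Finset.sum_image (by
      rintro ⟨a, l⟩ _ ⟨c, m⟩ _ h
      simpa using h), Finset.sum_product]
    simp only [closeCount_cons_cons, pow_add, ← Finset.mul_sum]
    calc _ ≤ ∑ a ∈ Finset.Icc 1 (n - 1),
          (n : ℝ) ^ (if 1 < |(b : ℤ) - a| then 0 else 1) * (4 * n) ^ k :=
          Finset.sum_le_sum fun a _ => mul_le_mul_of_nonneg_left (ih a) (by positivity)
      _ ≤ 4 * n * (4 * n) ^ k := by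
          rw [← Finset.sum_mul]
          exact mul_le_mul_of_nonneg_right (sum_pow_close_le n b) (by positivity)
      _ = _ := by ring

theorem sum_pow_closeCount_le (n k : ℕ) (hn : 1 ≤ n) :
    ∑ l ∈ wordsOfLength n k, (n : ℝ) ^ closeCount l ≤ (4 * n) ^ k :=
  (Finset.sum_le_sum fun l _ =>
    pow_le_pow_right₀ (by exact_mod_cast hn) (closeCount_le_cons 0 l)).trans
    (sum_pow_closeCount_cons_le n k 0)

/-- The finite set of reduced words for `w₀`. -/
noncomputable def reducedWords (n : ℕ) : Finset (List ℕ) :=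
  (wordsOfLength n (n * (n - 1) / 2)).filter (IsReducedWordFor n (w₀ n))

theorem mem_reducedWords {n : ℕ} {l : List ℕ} :
    l ∈ reducedWords n ↔ IsReducedWordFor n (w₀ n) l := by
  rw [reducedWords, Finset.mem_filter, mem_wordsOfLength]
  exact ⟨fun h => h.2, fun h => ⟨⟨length_of_isReducedWordFor_w₀ h, h.1.1⟩, h⟩⟩

theorem expectedStat_eq (n : ℕ) (f : List ℕ → ℕ) :
    expectedStat n f = (∑ l ∈ reducedWords n, (f l : ℝ)) / (reducedWords n).card := by
  have h : {l : List ℕ | IsReducedWordFor n (w₀ n) l} = ↑(reducedWords n) := by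
    ext l
    simp [mem_reducedWords]
  rw [expectedStat, h, finsum_mem_coe_finset,
    Nat.subtype_card (reducedWords n) fun _ => mem_reducedWords]

theorem pow_factorial_le_card_reducedWords (n : ℕ) :
    ((n - 1) / 2).factorial ^ n ≤ (reducedWords n).card :=
  (pow_factorial_le_card_brickWords n n).trans <| Finset.card_le_card fun _ hl =>
    mem_reducedWords.2 (isReducedWordFor_of_mem_brickWords hl)

/-- Jensen's inequality for the exponential, applied to an average over a finite set. -/
theorem sum_mul_log_le {α : Type*} (s : Finset α) (f : α → ℕ) {x : ℝ} {M : ℝ}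
    (hx : 0 < x) (hs : s.Nonempty) (hM : ∑ a ∈ s, x ^ f a ≤ M) :
    (∑ a ∈ s, (f a : ℝ)) / s.card * Real.log x ≤ Real.log M - Real.log s.card := by
  have hc : (0 : ℝ) < s.card := by exact_mod_cast hs.card_pos
  have hM0 : 0 < M := (Finset.sum_pos (fun a _ => pow_pos hx (f a)) hs).trans_le hM
  set c := Real.log M - Real.log s.card with hcdef
  have hexp : Real.exp (-c) = s.card / M := by
    rw [hcdef, neg_sub, Real.exp_sub, Real.exp_log hc, Real.exp_log hM0]
  have h1 : ∀ a ∈ s, (f a : ℝ) * Real.log x - c + 1 ≤ x ^ f a * (s.card / M) := by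
    intro a _
    have := Real.add_one_le_exp ((f a : ℝ) * Real.log x + -c)
    rw [Real.exp_add, hexp, Real.exp_nat_mul, Real.exp_log hx] at this
    linarith
  have h2 := Finset.sum_le_sum h1
  rw [← Finset.sum_mul, Finset.sum_add_distrib, Finset.sum_sub_distrib, ← Finset.sum_mul,
    Finset.sum_const, Finset.sum_const, nsmul_eq_mul, nsmul_eq_mul, mul_one] at h2
  have h3 : (∑ a ∈ s, x ^ f a) * (s.card / M) ≤ s.card := by
    calc _ ≤ M * (s.card / M) := mul_le_mul_of_nonneg_right hM (by positivity)
      _ = s.card := by field_simp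
  rw [div_mul_eq_mul_div, div_le_iff₀ hc]
  linarith

theorem mul_log_sub_le_log_factorial (m : ℕ) (hm : 0 < m) :
    m * Real.log m - m ≤ Real.log m.factorial := by
  have h := Real.pow_div_factorial_le_exp (m : ℝ) (Nat.cast_nonneg m) m
  have hm' : (0 : ℝ) < m := by exact_mod_cast hm
  have hf : (0 : ℝ) < m.factorial := by exact_mod_cast m.factorial_pos
  have := Real.log_le_log (by positivity) h
  rw [Real.log_exp, Real.log_div (by positivity) hf.ne', Real.log_pow] at this
  linarith

theorem cast_mul_sub_one_div_two (n : ℕ) :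
    ((n * (n - 1) / 2 : ℕ) : ℝ) = (n : ℝ) * ((n : ℝ) - 1) / 2 := by
  rw [← Nat.choose_two_right, Nat.cast_choose_two]

theorem expectedStat_commCount (n : ℕ) (hn : 2 ≤ n) :
    expectedStat n commCount =
      (n : ℝ) * ((n : ℝ) - 1) / 2 - 1 - expectedStat n closeCount := by
  have hne : (0 : ℝ) < (reducedWords n).card := by
    exact_mod_cast (pow_pos (Nat.factorial_pos _) n).trans_le
      (pow_factorial_le_card_reducedWords n)
  rw [expectedStat_eq, expectedStat_eq, eq_sub_iff_add_eq, ← add_div, div_eq_iff hne.ne',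
    ← Finset.sum_add_distrib, mul_comm, ← nsmul_eq_mul]
  refine Finset.sum_eq_card_nsmul fun l hl => ?_
  have h1 := commCount_add_closeCount l
  rw [length_of_isReducedWordFor_w₀ (mem_reducedWords.1 hl)] at h1
  have h2 : 1 ≤ n * (n - 1) / 2 := by
    rw [Nat.le_div_iff_mul_le two_pos]
    exact Nat.mul_le_mul hn (by omega : 1 ≤ n - 1) |>.trans' (by norm_num)
  rw [← cast_mul_sub_one_div_two]
  have h3 : commCount l + closeCount l + 1 = n * (n - 1) / 2 := by omega
  rw [← h3]
  push_cast
  ring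

theorem expectedStat_closeCount_le (n : ℕ) (hn : 8 ≤ n) :
    expectedStat n closeCount / ((n : ℝ) * ((n : ℝ) - 1) / 2) ≤
      (2 * Real.log 4 + 2) / Real.log n := by
  set m := (n - 1) / 2 with hm
  have hn' : (8 : ℝ) ≤ n := by exact_mod_cast hn
  have hlog : 0 < Real.log n := Real.log_pos (by linarith)
  have hcard := pow_factorial_le_card_reducedWords n
  have hne : (reducedWords n).Nonempty :=
    Finset.card_pos.1 ((pow_pos (Nat.factorial_pos _) n).trans_le hcard)
  have hsum : ∑ l ∈ reducedWords n, (n : ℝ) ^ closeCount l ≤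
      (4 * n) ^ (n * (n - 1) / 2) :=
    (Finset.sum_le_sum_of_subset_of_nonneg (Finset.filter_subset _ _)
      fun _ _ _ => by positivity).trans (sum_pow_closeCount_le n _ (by omega))
  have hJ := sum_mul_log_le (reducedWords n) closeCount (by linarith) hne hsum
  rw [← expectedStat_eq, Real.log_pow, cast_mul_sub_one_div_two,
    Real.log_mul (by norm_num) (by linarith)] at hJ
  have hr : n * (m * Real.log m - m) ≤ Real.log (reducedWords n).card := by
    calc (n : ℝ) * (m * Real.log m - m) ≤ n * Real.log m.factorial :=
          mul_le_mul_of_nonneg_left (mul_log_sub_le_log_factorial m (by omega)) (by positivity)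
      _ = Real.log (((m.factorial ^ n : ℕ)) : ℝ) := by rw [Nat.cast_pow, Real.log_pow]
      _ ≤ _ := Real.log_le_log (by positivity) (by exact_mod_cast hcard)
  have hm1 : ((n : ℝ) - 2) / 2 ≤ m := by
    have : (n : ℝ) ≤ 2 * m + 2 := by exact_mod_cast (by omega : n ≤ 2 * m + 2)
    linarith
  have hm2 : (m : ℝ) ≤ (n - 1) / 2 := by
    have : (2 * m + 1 : ℝ) ≤ n := by exact_mod_cast (by omega : 2 * m + 1 ≤ n)
    linarith
  have hlm : Real.log n - Real.log 4 ≤ Real.log m := by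
    rw [← Real.log_div (by linarith) (by norm_num)]
    exact Real.log_le_log (by linarith) (by linarith)
  have hl4 : Real.log 4 ≤ Real.log n := Real.log_le_log (by norm_num) (by linarith)
  have hl4' : 0 ≤ Real.log 4 := Real.log_nonneg (by norm_num)
  have hln : Real.log n ≤ n - 1 := Real.log_le_sub_one_of_pos (by linarith)
  have hprod : ((n : ℝ) - 2) / 2 * (Real.log n - Real.log 4) ≤ m * Real.log m :=
    mul_le_mul hm1 hlm (by linarith) (by linarith)
  have hkey : ((n : ℝ) - 1) / 2 * (Real.log n - Real.log 4 - 2) ≤ m * Real.log m - m := by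
    linarith
  have hkey' := mul_le_mul_of_nonneg_left hkey (by linarith : (0 : ℝ) ≤ n)
  rw [div_le_div_iff₀ (by nlinarith) hlog]
  linarith

/-- The expected number of positions supporting a commutation in a uniformly random
reduced word for `w₀ ∈ S_n`, divided by the length `n(n-1)/2`, tends to `1`. -/
theorem commutation_frequency :
    Filter.Tendsto
      (fun n : ℕ => expectedStat n commCount / ((n : ℝ) * ((n : ℝ) - 1) / 2))
      Filter.atTop (nhds 1) := by
  have hlower : Filter.Tendsto (fun n : ℕ => 1 - 1 / ((n : ℝ) * ((n : ℝ) - 1) / 2) -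
      (2 * Real.log 4 + 2) / Real.log n) Filter.atTop (nhds 1) := by
    have h1 : Filter.Tendsto (fun n : ℕ => (n : ℝ) * ((n : ℝ) - 1) / 2)
        Filter.atTop Filter.atTop := by
      refine Filter.Tendsto.atTop_div_const two_pos ?_
      exact tendsto_natCast_atTop_atTop.atTop_mul_atTop₀
        (Filter.tendsto_atTop_add_const_right _ (-1) tendsto_natCast_atTop_atTop)
    have h2 : Filter.Tendsto (fun n : ℕ => Real.log n) Filter.atTop Filter.atTop :=
      Real.tendsto_log_atTop.comp tendsto_natCast_atTop_atTop
    simpa using (tendsto_const_nhds.sub (h1.const_div_atTop 1)).sub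
      (h2.const_div_atTop (2 * Real.log 4 + 2))
  refine tendsto_of_tendsto_of_tendsto_of_le_of_le' hlower tendsto_const_nhds ?_ ?_
  · filter_upwards [Filter.eventually_ge_atTop 8] with n hn
    have hn' : (8 : ℝ) ≤ n := by exact_mod_cast hn
    have hpos : 0 < (n : ℝ) * ((n : ℝ) - 1) / 2 := by nlinarith
    have h := expectedStat_closeCount_le n hn
    rw [expectedStat_commCount n (by omega), sub_div, sub_div, div_self hpos.ne']
    linarith
  · filter_upwards [Filter.eventually_ge_atTop 8] with n hn
    have hn' : (8 : ℝ) ≤ n := by exact_mod_cast hn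
    have hpos : 0 < (n : ℝ) * ((n : ℝ) - 1) / 2 := by nlinarith
    have h : 0 ≤ expectedStat n closeCount := by
      rw [expectedStat_eq]
      positivity
    rw [expectedStat_commCount n (by omega), div_le_one hpos]
    linarith
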